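/- arXiv:1605.06071 — 5 statements merged into one kernel-verified Lean document; each statement's English description precedes it below -/
import Mathlib

section
/- Let U : ℝ → M_n(ℂ) be measurable with U(x) unitary for a.e. x, let α₁,…,αₙ, γ₁,…,γₙ ∈ ℝ, and let W(x) = U(x) · diag(α₁|x|^{γ₁},…,αₙ|x|^{γₙ}) · U(x)*. If W is an A₂ matrix weight, then αᵢ > 0 and −1 < γᵢ < 1 for all 1 ≤ i ≤ n. -/
open MeasureTheory Matrix
open scoped ComplexOrder

/-- The entrywise average `⟨W⟩_I` of a matrix function over the interval `(a, b)`. -/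
noncomputable def matrixAvg (n : ℕ) (W : ℝ → Matrix (Fin n) (Fin n) ℂ) (a b : ℝ) :
    Matrix (Fin n) (Fin n) ℂ :=
  Matrix.of fun i j => (b - a)⁻¹ • ∫ x in a..b, W x i j

/-- `W` is an `A₂` matrix weight: it is positive definite a.e., the entries of `W` and
`W⁻¹` are locally integrable, and `sup_I Trace(⟨W⟩_I ⟨W⁻¹⟩_I) < ∞`, the supremum being
over all bounded intervals of positive length. -/
def IsA2MatrixWeight (n : ℕ) (W : ℝ → Matrix (Fin n) (Fin n) ℂ) : Prop :=
  (∀ᵐ x : ℝ, (W x).PosDef) ∧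
  (∀ i j : Fin n, LocallyIntegrable (fun x => W x i j) volume) ∧
  (∀ i j : Fin n, LocallyIntegrable (fun x => (W x)⁻¹ i j) volume) ∧
  ∃ C : ℝ, ∀ a b : ℝ, a < b →
    ‖(matrixAvg n W a b * matrixAvg n (fun x => (W x)⁻¹) a b).trace‖ ≤ C

/-- A trace of a matrix function which is a.e. unitarily conjugate to `diag(βᵢ |x|^γᵢ)` controls
each `βᵢ |x|^γᵢ`, so local integrability of the diagonal entries forces `-1 < γᵢ`. -/
theorem neg_one_lt_of_locallyIntegrable_unitary_conj (n : ℕ)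
    (U A : ℝ → Matrix (Fin n) (Fin n) ℂ)
    (hU : ∀ᵐ x : ℝ, U x ∈ Matrix.unitaryGroup (Fin n) ℂ)
    (β γ : Fin n → ℝ) (hβ : ∀ i, 0 < β i)
    (hA : ∀ᵐ x : ℝ, A x =
      U x * Matrix.diagonal (fun i => ((β i * |x| ^ γ i : ℝ) : ℂ)) * (U x)ᴴ)
    (hloc : ∀ i, LocallyIntegrable (fun x => A x i i) volume) (i : Fin n) :
    -1 < γ i := by
  have htr : ∀ᵐ x : ℝ, ∑ j, A x j j = ((∑ j, β j * |x| ^ γ j : ℝ) : ℂ) := by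
    filter_upwards [hU, hA] with x hUx hAx
    have h1 : (U x)ᴴ * U x = 1 := Matrix.mem_unitaryGroup_iff'.1 hUx
    have h2 : (A x).trace = ∑ j, ((β j * |x| ^ γ j : ℝ) : ℂ) := by
      rw [hAx, Matrix.trace_mul_comm, ← Matrix.mul_assoc, h1, Matrix.one_mul,
        Matrix.trace_diagonal]
    rw [Complex.ofReal_sum, ← h2]
    rfl
  have hsum : IntegrableOn (fun x => ∑ j, A x j j) (Set.Ioo (0 : ℝ) 1) :=
    integrable_finsetSum _ fun j _ =>
      ((hloc j).integrableOn_isCompact isCompact_Icc).mono_set Set.Ioo_subset_Icc_self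
  have hpow : IntegrableOn (fun x : ℝ => x ^ γ i) (Set.Ioo 0 1) := by
    refine (hsum.const_mul ((β i)⁻¹ : ℂ)).mono
      (Measurable.aestronglyMeasurable (by fun_prop)) ?_
    filter_upwards [ae_restrict_of_ae htr, ae_restrict_mem measurableSet_Ioo] with x hx hx0
    have hpos : 0 < x := hx0.1
    have hle : β i * |x| ^ γ i ≤ ∑ j, β j * |x| ^ γ j :=
      Finset.single_le_sum (f := fun j => β j * |x| ^ γ j)
        (fun j _ => by have := hβ j; positivity) (Finset.mem_univ i)
    have hi := hβ i
    rw [hx, norm_mul, norm_inv, Complex.norm_real, Complex.norm_real, Real.norm_of_nonneg hi.le,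
      Real.norm_of_nonneg (by positivity),
      Real.norm_of_nonneg (le_trans (by positivity) hle), le_inv_mul_iff₀ hi]
    rwa [abs_of_pos hpos] at hle ⊢
  exact (intervalIntegral.integrableOn_Ioo_rpow_iff one_pos).1 hpow

/-- The inverse of a unitary conjugate of an invertible diagonal matrix. -/
theorem inv_unitary_conj_diagonal {n : ℕ} {V : Matrix (Fin n) (Fin n) ℂ}
    (hV : V ∈ Matrix.unitaryGroup (Fin n) ℂ) {d e : Fin n → ℂ} (hde : ∀ i, d i * e i = 1) :
    (V * Matrix.diagonal d * Vᴴ)⁻¹ = V * Matrix.diagonal e * Vᴴ := by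
  have h1 : Vᴴ * V = 1 := Matrix.mem_unitaryGroup_iff'.1 hV
  have h2 : V * Vᴴ = 1 := Matrix.mem_unitaryGroup_iff.1 hV
  have h3 : Matrix.diagonal d * Matrix.diagonal e = 1 := by
    simp [Matrix.diagonal_mul_diagonal, hde]
  apply Matrix.inv_eq_right_inv
  calc V * Matrix.diagonal d * Vᴴ * (V * Matrix.diagonal e * Vᴴ)
      = V * Matrix.diagonal d * (Vᴴ * V) * Matrix.diagonal e * Vᴴ := by
        simp only [Matrix.mul_assoc]
    _ = V * (Matrix.diagonal d * Matrix.diagonal e) * Vᴴ := by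
        rw [h1, Matrix.mul_one, Matrix.mul_assoc V]
    _ = 1 := by rw [h3, Matrix.mul_one, h2]

/-- If a Type 2 matrix power function
`W(x) = U(x) diag(αᵢ |x|^γᵢ) U(x)*`, with `U(x)` unitary a.e., is an `A₂` matrix
weight, then `αᵢ > 0` and `-1 < γᵢ < 1` for all `i`. -/
theorem type2_isA2_necessary (n : ℕ)
    (U : ℝ → Matrix (Fin n) (Fin n) ℂ)
    (hUmeas : ∀ i j : Fin n, Measurable fun x => U x i j)
    (hU : ∀ᵐ x : ℝ, U x ∈ Matrix.unitaryGroup (Fin n) ℂ)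
    (α γ : Fin n → ℝ)
    (W : ℝ → Matrix (Fin n) (Fin n) ℂ)
    (hW : ∀ x : ℝ, W x =
      U x * Matrix.diagonal (fun i => ((α i * |x| ^ γ i : ℝ) : ℂ)) * (U x)ᴴ)
    (hA2 : IsA2MatrixWeight n W) :
    ∀ i : Fin n, 0 < α i ∧ -1 < γ i ∧ γ i < 1 := by
  obtain ⟨hpd, hloc, hlocInv, -⟩ := hA2
  have hne : ∀ᵐ x : ℝ, x ≠ 0 := by simp [ae_iff]
  have hα : ∀ i, 0 < α i := by
    intro i
    obtain ⟨x, hUx, hx, hx0⟩ := (hU.and (hpd.and hne)).exists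
    have hunit : IsUnit (U x) := Unitary.isUnit_coe (U := ⟨U x, hUx⟩)
    rw [hW x, ← Matrix.star_eq_conjTranspose,
      Matrix.IsUnit.posDef_star_right_conjugate_iff hunit, Matrix.posDef_diagonal_iff] at hx
    have := Complex.zero_lt_real.1 (hx i)
    exact pos_of_mul_pos_left this (by positivity)
  refine fun i => ⟨hα i, ?_, ?_⟩
  · exact neg_one_lt_of_locallyIntegrable_unitary_conj n U W hU α γ hα
      (Filter.Eventually.of_forall hW) (fun j => hloc j j) i
  · have hinv : ∀ᵐ x : ℝ, (W x)⁻¹ = U x *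
        Matrix.diagonal (fun j => (((α j)⁻¹ * |x| ^ (-γ j) : ℝ) : ℂ)) * (U x)ᴴ := by
      filter_upwards [hU, hne] with x hUx hx0
      rw [hW x]
      refine inv_unitary_conj_diagonal hUx fun j => ?_
      have hx : |x| ^ γ j ≠ 0 := (Real.rpow_pos_of_pos (abs_pos.2 hx0) _).ne'
      have hj := (hα j).ne'
      rw [← Complex.ofReal_mul, Real.rpow_neg (abs_nonneg x), Complex.ofReal_eq_one]
      field_simp
    have := neg_one_lt_of_locallyIntegrable_unitary_conj n U (fun x => (W x)⁻¹) hU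
      (fun j => (α j)⁻¹) (fun j => -γ j) (fun j => inv_pos.2 (hα j)) hinv
      (fun j => hlocInv j j) i
    linarith
end

section
/- Let γ₁, γ₂ ∈ ℝ and define W : ℝ → M₂(ℝ) by W(x) = R(x) · diag(|x|^{γ₁}, |x|^{γ₂}) · R(x)ᵀ, where R(x) is the rotation matrix with rows (cos x, −sin x) and (sin x, cos x). Then W is an A₂ matrix weight if and only if γ₁ = γ₂ and −1 < γ₁ < 1. -/
open MeasureTheory Matrix Real

/-- The entrywise average `⟨W⟩_I` of a real matrix function over the interval `(a, b)`. -/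
noncomputable def matrixAvgR (n : ℕ) (W : ℝ → Matrix (Fin n) (Fin n) ℝ) (a b : ℝ) :
    Matrix (Fin n) (Fin n) ℝ :=
  Matrix.of fun i j => (b - a)⁻¹ • ∫ x in a..b, W x i j

/-- A real matrix function `W` is an `A₂` matrix weight: it is positive definite a.e.,
the entries of `W` and `W⁻¹` are locally integrable, and
`sup_I Trace(⟨W⟩_I ⟨W⁻¹⟩_I) < ∞`, over all bounded intervals of positive length. -/
def IsA2MatrixWeightR (n : ℕ) (W : ℝ → Matrix (Fin n) (Fin n) ℝ) : Prop :=
  (∀ᵐ x : ℝ, (W x).PosDef) ∧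
  (∀ i j : Fin n, LocallyIntegrable (fun x => W x i j) volume) ∧
  (∀ i j : Fin n, LocallyIntegrable (fun x => (W x)⁻¹ i j) volume) ∧
  ∃ C : ℝ, ∀ a b : ℝ, a < b →
    (matrixAvgR n W a b * matrixAvgR n (fun x => (W x)⁻¹) a b).trace ≤ C

/-- Powers with exponent in `[-1, 1]` lose at most a factor `2` on `[T, 2T]`. -/
lemma half_rpow_le_rpow {T x γ : ℝ} (hT : 0 < T) (h₁ : T ≤ x) (h₂ : x ≤ 2 * T) (hγ : -1 ≤ γ) :
    T ^ γ / 2 ≤ x ^ γ := by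
  have hTγ : 0 < T ^ γ := rpow_pos_of_pos hT γ
  rcases le_total 0 γ with h | h
  · linarith [rpow_le_rpow hT.le h₁ h]
  · have h3 : (2 * T) ^ γ ≤ x ^ γ := rpow_le_rpow_of_nonpos (hT.trans_le h₁) h₂ h
    have h4 : (2 : ℝ) ^ (-1 : ℝ) ≤ 2 ^ γ := rpow_le_rpow_of_exponent_le (by norm_num) hγ
    rw [mul_rpow (by norm_num) hT.le] at h3
    rw [rpow_neg_one] at h4
    nlinarith

lemma rpow_le_two_mul_rpow {T x γ : ℝ} (hT : 0 < T) (h₁ : T ≤ x) (h₂ : x ≤ 2 * T) (hγ : γ ≤ 1) :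
    x ^ γ ≤ 2 * T ^ γ := by
  have h := half_rpow_le_rpow hT h₁ h₂ (neg_le_neg hγ)
  rw [rpow_neg hT.le, rpow_neg (hT.trans_le h₁).le] at h
  have hTγ : 0 < T ^ γ := rpow_pos_of_pos hT γ
  have hxγ : 0 < x ^ γ := rpow_pos_of_pos (hT.trans_le h₁) γ
  field_simp at h
  linarith

lemma locallyIntegrable_abs_rpow {γ : ℝ} (hγ : -1 < γ) :
    LocallyIntegrable (fun x : ℝ => |x| ^ γ) volume := by
  refine locallyIntegrable_of_norm_le_rpow (C := 1) (α := -γ) (by simp) (by simp; linarith) ?_ ?_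
  · filter_upwards with x
    rw [neg_neg, one_mul, norm_of_nonneg (rpow_nonneg (abs_nonneg x) γ), norm_eq_abs]
  · exact (Measurable.pow_const (by fun_prop) γ).aestronglyMeasurable

lemma intervalIntegrable_abs_rpow {γ : ℝ} (hγ : -1 < γ) (a b : ℝ) :
    IntervalIntegrable (fun x : ℝ => |x| ^ γ) volume a b :=
  ((locallyIntegrable_abs_rpow hγ).integrableOn_isCompact isCompact_uIcc).intervalIntegrable

lemma integral_abs_rpow_symm {γ M : ℝ} (hγ : -1 < γ) (hM : 0 ≤ M) :
    ∫ x in (-M)..M, |x| ^ γ = 2 * (M ^ (γ + 1) / (γ + 1)) := by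
  have hpos : ∫ x in (0 : ℝ)..M, |x| ^ γ = M ^ (γ + 1) / (γ + 1) := by
    have : ∫ x in (0 : ℝ)..M, |x| ^ γ = ∫ x in (0 : ℝ)..M, x ^ γ := by
      refine intervalIntegral.integral_congr fun x hx => ?_
      rw [Set.uIcc_of_le hM] at hx
      simp only [abs_of_nonneg hx.1]
    rw [this, integral_rpow (Or.inl hγ), zero_rpow (by linarith), sub_zero]
  have hneg : ∫ x in (-M)..0, |x| ^ γ = ∫ x in (0 : ℝ)..M, |x| ^ γ := by
    simpa using (intervalIntegral.integral_comp_neg (a := 0) (b := M) (fun x : ℝ => |x| ^ γ)).symm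
  rw [← intervalIntegral.integral_add_adjacent_intervals
    (intervalIntegrable_abs_rpow hγ (-M) 0) (intervalIntegrable_abs_rpow hγ 0 M), hneg, hpos]
  ring

lemma integral_abs_rpow_le {γ M a b : ℝ} (hγ : -1 < γ) (hab : a ≤ b) (ha : |a| ≤ M)
    (hb : |b| ≤ M) :
    ∫ x in a..b, |x| ^ γ ≤ 2 * (M ^ (γ + 1) / (γ + 1)) := by
  rw [← integral_abs_rpow_symm hγ ((abs_nonneg a).trans ha)]
  refine intervalIntegral.integral_mono_interval (abs_le.1 ha).1 hab (abs_le.1 hb).2 ?_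
    (intervalIntegrable_abs_rpow hγ _ _)
  filter_upwards with x
  exact rpow_nonneg (abs_nonneg x) γ

lemma integral_abs_rpow_le_of_subset {γ T a b : ℝ} (hγ : -1 < γ) (hγ' : γ ≤ 1) (hT : 0 < T)
    (hab : a ≤ b) (h : ∀ x ∈ Set.Icc a b, T ≤ |x| ∧ |x| ≤ 2 * T) :
    ∫ x in a..b, |x| ^ γ ≤ (b - a) * (2 * T ^ γ) := by
  have := intervalIntegral.integral_mono_on hab (intervalIntegrable_abs_rpow hγ a b)
    (intervalIntegrable_const (c := 2 * T ^ γ))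
    fun x hx => rpow_le_two_mul_rpow hT (h x hx).1 (h x hx).2 hγ'
  rwa [intervalIntegral.integral_const, smul_eq_mul] at this

/-- The scalar power weight `|x|^γ`, `-1 < γ < 1`, satisfies the `A₂` condition. -/
lemma integral_abs_rpow_mul_integral_abs_rpow_neg_le {γ a b : ℝ} (h₁ : -1 < γ) (h₂ : γ < 1)
    (hab : a < b) :
    (∫ x in a..b, |x| ^ γ) * (∫ x in a..b, |x| ^ (-γ)) ≤
      16 / ((1 + γ) * (1 - γ)) * (b - a) ^ 2 := by
  have hnn : ∀ δ : ℝ, 0 ≤ ∫ x in a..b, |x| ^ δ := fun δ =>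
    intervalIntegral.integral_nonneg hab.le fun x _ => rpow_nonneg (abs_nonneg x) δ
  have hp : 0 < (1 + γ) * (1 - γ) := mul_pos (by linarith) (by linarith)
  set M := max |a| |b|
  have ha : |a| ≤ M := le_max_left _ _
  have hb : |b| ≤ M := le_max_right _ _
  have hM0 : 0 < M := by
    by_contra! h
    have ha0 : a = 0 := abs_nonpos_iff.1 (ha.trans h)
    have hb0 : b = 0 := abs_nonpos_iff.1 (hb.trans h)
    linarith
  rcases le_total (M / 2) (b - a) with h | h
  · have e : M ^ (γ + 1) * M ^ (-γ + 1) = M ^ 2 := by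
      rw [← rpow_add hM0, ← rpow_natCast]
      congr 1
      push_cast
      ring
    calc
      _ ≤ (2 * (M ^ (γ + 1) / (γ + 1))) * (2 * (M ^ (-γ + 1) / (-γ + 1))) :=
        mul_le_mul (integral_abs_rpow_le h₁ hab.le ha hb)
          (integral_abs_rpow_le (by linarith) hab.le ha hb) (hnn _)
          ((hnn γ).trans (integral_abs_rpow_le h₁ hab.le ha hb))
      _ = 4 / ((1 + γ) * (1 - γ)) * (M ^ (γ + 1) * M ^ (-γ + 1)) := by
        have : γ + 1 ≠ 0 := by linarith
        have : 1 - γ ≠ 0 := by linarith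
        rw [add_comm 1 γ, neg_add_eq_sub]
        field_simp
        ring
      _ = 4 / ((1 + γ) * (1 - γ)) * M ^ 2 := by rw [e]
      _ ≤ 4 / ((1 + γ) * (1 - γ)) * (4 * (b - a) ^ 2) := by
        gcongr
        nlinarith
      _ = _ := by ring
  · have hT : ∀ x ∈ Set.Icc a b, M / 2 ≤ |x| ∧ |x| ≤ 2 * (M / 2) := by
      intro x hx
      refine ⟨?_, ?_⟩
      · rcases le_total |a| |b| with h' | h'
        · have : M = |b| := max_eq_right h'
          have h3 := abs_sub_abs_le_abs_sub b x
          rw [abs_of_nonneg (sub_nonneg.2 hx.2)] at h3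
          linarith [hx.1]
        · have : M = |a| := max_eq_left h'
          have h3 := abs_sub_abs_le_abs_sub a x
          rw [abs_sub_comm, abs_of_nonneg (sub_nonneg.2 hx.1)] at h3
          linarith [hx.2]
      · rw [mul_div_cancel₀ M two_ne_zero]
        exact abs_le_max_abs_abs hx.1 hx.2
    have h3 := integral_abs_rpow_le_of_subset h₁ h₂.le (half_pos hM0) hab.le hT
    have h4 := integral_abs_rpow_le_of_subset (γ := -γ) (by linarith) (by linarith)
      (half_pos hM0) hab.le hT
    have e : (M / 2) ^ γ * (M / 2) ^ (-γ) = 1 := by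
      rw [← rpow_add (half_pos hM0), add_neg_cancel, rpow_zero]
    calc
      _ ≤ ((b - a) * (2 * (M / 2) ^ γ)) * ((b - a) * (2 * (M / 2) ^ (-γ))) :=
        mul_le_mul h3 h4 (hnn _) ((hnn γ).trans h3)
      _ = 4 * ((M / 2) ^ γ * (M / 2) ^ (-γ)) * (b - a) ^ 2 := by ring
      _ = 4 * (b - a) ^ 2 := by rw [e, mul_one]
      _ ≤ _ := by
        gcongr
        rw [le_div_iff₀ hp]
        nlinarith

/-- If two symmetric `2 × 2` matrices dominate `α` and `β`, their product has trace at least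
`2αβ`. -/
lemma two_mul_le_trace_mul {A B : Matrix (Fin 2) (Fin 2) ℝ} {α β : ℝ} (hα : 0 ≤ α) (hβ : 0 ≤ β)
    (sA : A 1 0 = A 0 1) (sB : B 1 0 = B 0 1)
    (hA : ∀ u v : ℝ, α * (u ^ 2 + v ^ 2) ≤
      A 0 0 * u ^ 2 + (A 0 1 + A 1 0) * (u * v) + A 1 1 * v ^ 2)
    (hB : ∀ u v : ℝ, β * (u ^ 2 + v ^ 2) ≤
      B 0 0 * u ^ 2 + (B 0 1 + B 1 0) * (u * v) + B 1 1 * v ^ 2) :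
    2 * (α * β) ≤ (A * B).trace := by
  have key : ∀ (M : Matrix (Fin 2) (Fin 2) ℝ) (m : ℝ), M 1 0 = M 0 1 →
      (∀ u v : ℝ, m * (u ^ 2 + v ^ 2) ≤
        M 0 0 * u ^ 2 + (M 0 1 + M 1 0) * (u * v) + M 1 1 * v ^ 2) →
      0 ≤ M 0 0 - m ∧ 0 ≤ M 1 1 - m ∧ M 0 1 ^ 2 ≤ (M 0 0 - m) * (M 1 1 - m) := by
    intro M m s h
    refine ⟨by linarith [h 1 0], by linarith [h 0 1], ?_⟩
    have := discrim_le_zero (a := M 0 0 - m) (b := 2 * M 0 1) (c := M 1 1 - m)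
      fun x => by
        have := h x 1
        rw [s] at this
        linarith
    rw [discrim] at this
    linarith
  obtain ⟨a₁, a₂, a₃⟩ := key A α sA hA
  obtain ⟨b₁, b₂, b₃⟩ := key B β sB hB
  rw [trace_fin_two, mul_apply, mul_apply, Fin.sum_univ_two, Fin.sum_univ_two, sA, sB]
  have h₁ : (A 0 1 * B 0 1) ^ 2 ≤
      ((A 0 0 - α) * (B 0 0 - β)) * ((A 1 1 - α) * (B 1 1 - β)) := by
    rw [mul_pow]
    calc _ ≤ ((A 0 0 - α) * (A 1 1 - α)) * ((B 0 0 - β) * (B 1 1 - β)) :=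
          mul_le_mul a₃ b₃ (sq_nonneg _) (mul_nonneg a₁ a₂)
      _ = _ := by ring
  have p₁ := mul_nonneg a₁ b₁
  have p₂ := mul_nonneg a₂ b₂
  have h₂ : |2 * (A 0 1 * B 0 1)| ≤ (A 0 0 - α) * (B 0 0 - β) + (A 1 1 - α) * (B 1 1 - β) := by
    refine abs_le_of_sq_le_sq ?_ (add_nonneg p₁ p₂)
    nlinarith [sq_nonneg ((A 0 0 - α) * (B 0 0 - β) - (A 1 1 - α) * (B 1 1 - β))]
  have h₃ := (abs_le.1 h₂).1
  nlinarith [mul_nonneg hα b₁, mul_nonneg hα b₂, mul_nonneg hβ a₁, mul_nonneg hβ a₂]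

lemma integral_rotating_line_sq (T φ u v : ℝ) :
    ∫ x in T..(T + π), (cos (x + φ) * u + sin (x + φ) * v) ^ 2 = π / 2 * (u ^ 2 + v ^ 2) := by
  rw [intervalIntegral.integral_comp_add_right (fun x => (cos x * u + sin x * v) ^ 2)]
  have e : ∀ x : ℝ, (cos x * u + sin x * v) ^ 2 =
      u ^ 2 * cos x ^ 2 + 2 * u * v * (sin x * cos x) + v ^ 2 * sin x ^ 2 := fun x => by ring
  simp_rw [e]
  rw [intervalIntegral.integral_add, intervalIntegral.integral_add,
    intervalIntegral.integral_const_mul, intervalIntegral.integral_const_mul,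
    intervalIntegral.integral_const_mul, integral_cos_sq, integral_sin_sq, integral_sin_mul_cos₁]
  · rw [add_right_comm T π φ, sin_add_pi, cos_add_pi]
    ring
  all_goals exact Continuous.intervalIntegrable (by fun_prop) _ _

/-- A matrix function dominating a multiple of the projection to a rotating line dominates, on
average over a half-turn, a multiple of the identity. -/
lemma matrixAvgR_quadratic_lower {V : ℝ → Matrix (Fin 2) (Fin 2) ℝ} {T φ α : ℝ}
    (hV : ∀ i j, LocallyIntegrable (fun x => V x i j) volume)
    (h : ∀ x ∈ Set.Icc T (T + π), ∀ u v : ℝ,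
      α * (cos (x + φ) * u + sin (x + φ) * v) ^ 2 ≤
        V x 0 0 * u ^ 2 + (V x 0 1 + V x 1 0) * (u * v) + V x 1 1 * v ^ 2) (u v : ℝ) :
    α / 2 * (u ^ 2 + v ^ 2) ≤
      matrixAvgR 2 V T (T + π) 0 0 * u ^ 2 +
        (matrixAvgR 2 V T (T + π) 0 1 + matrixAvgR 2 V T (T + π) 1 0) * (u * v) +
        matrixAvgR 2 V T (T + π) 1 1 * v ^ 2 := by
  have hI : ∀ i j, IntervalIntegrable (fun x => V x i j) volume T (T + π) :=
    fun i j => ((hV i j).integrableOn_isCompact isCompact_uIcc).intervalIntegrable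
  have hle := intervalIntegral.integral_mono_on (by linarith [pi_pos])
    (Continuous.intervalIntegrable (by fun_prop) T (T + π))
    ((((hI 0 0).mul_const (u ^ 2)).add (((hI 0 1).add (hI 1 0)).mul_const (u * v))).add
      ((hI 1 1).mul_const (v ^ 2))) fun x hx => h x hx u v
  rw [intervalIntegral.integral_const_mul, integral_rotating_line_sq,
    intervalIntegral.integral_add (((hI 0 0).mul_const (u ^ 2)).add
      (((hI 0 1).add (hI 1 0)).mul_const (u * v))) ((hI 1 1).mul_const (v ^ 2)),
    intervalIntegral.integral_add ((hI 0 0).mul_const (u ^ 2))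
      (((hI 0 1).add (hI 1 0)).mul_const (u * v)),
    intervalIntegral.integral_mul_const, intervalIntegral.integral_mul_const,
    intervalIntegral.integral_mul_const,
    intervalIntegral.integral_add (hI 0 1) (hI 1 0)] at hle
  simp only [matrixAvgR, of_apply, smul_eq_mul, add_sub_cancel_left]
  have hπ := pi_pos
  have := mul_le_mul_of_nonneg_left hle (inv_nonneg.2 hπ.le)
  calc _ = π⁻¹ * (α * (π / 2 * (u ^ 2 + v ^ 2))) := by field_simp
    _ ≤ _ := this
    _ = _ := by ring

lemma matrixAvgR_symm {V : ℝ → Matrix (Fin 2) (Fin 2) ℝ} (h : ∀ x, V x 1 0 = V x 0 1) (a b : ℝ) :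
    matrixAvgR 2 V a b 1 0 = matrixAvgR 2 V a b 0 1 := by
  simp [matrixAvgR, h]

/-- The symmetric matrix with eigenvalues `p`, `q` and eigenbasis rotated through the angle `x`. -/
noncomputable def rotatedDiagonal (p q x : ℝ) : Matrix (Fin 2) (Fin 2) ℝ :=
  !![p * cos x ^ 2 + q * sin x ^ 2, (p - q) * (cos x * sin x);
    (p - q) * (cos x * sin x), p * sin x ^ 2 + q * cos x ^ 2]

lemma rotation_mul_diagonal_mul_transpose (p q x : ℝ) :
    !![cos x, -sin x; sin x, cos x] * Matrix.diagonal ![p, q] *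
      (!![cos x, -sin x; sin x, cos x])ᵀ = rotatedDiagonal p q x := by
  ext i j
  fin_cases i <;> fin_cases j <;>
    simp [rotatedDiagonal, mul_apply, Fin.sum_univ_two, vecMul_diagonal] <;> ring

lemma rotatedDiagonal_quadratic (p q x u v : ℝ) :
    rotatedDiagonal p q x 0 0 * u ^ 2 +
      (rotatedDiagonal p q x 0 1 + rotatedDiagonal p q x 1 0) * (u * v) +
      rotatedDiagonal p q x 1 1 * v ^ 2 =
    p * (cos x * u + sin x * v) ^ 2 + q * (-sin x * u + cos x * v) ^ 2 := by
  simp [rotatedDiagonal]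
  ring

lemma rotatedDiagonal_symm (p q x : ℝ) :
    rotatedDiagonal p q x 1 0 = rotatedDiagonal p q x 0 1 := by
  simp [rotatedDiagonal]

lemma rotatedDiagonal_trace (p q x : ℝ) :
    rotatedDiagonal p q x 0 0 + rotatedDiagonal p q x 1 1 = p + q := by
  simp [rotatedDiagonal]
  linear_combination (p + q) * sin_sq_add_cos_sq x

lemma rotatedDiagonal_self (p x : ℝ) : rotatedDiagonal p p x = p • 1 := by
  have h : p * cos x ^ 2 + p * sin x ^ 2 = p := by
    linear_combination p * sin_sq_add_cos_sq x
  have h' : p * sin x ^ 2 + p * cos x ^ 2 = p := by rw [add_comm, h]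
  ext i j
  fin_cases i <;> fin_cases j <;> simp [rotatedDiagonal, h, h']

lemma rotatedDiagonal_inv {p q : ℝ} (hp : p ≠ 0) (hq : q ≠ 0) (x : ℝ) :
    (rotatedDiagonal p q x)⁻¹ = rotatedDiagonal p⁻¹ q⁻¹ x := by
  refine inv_eq_right_inv ?_
  have hs : sin x ^ 2 = 1 - cos x ^ 2 := sin_sq x
  ext i j
  fin_cases i <;> fin_cases j <;>
    simp [rotatedDiagonal, mul_apply, Fin.sum_univ_two] <;> field_simp <;> grind

/-- On a far away half-turn, the average of a rotated diagonal power weight dominates the identity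
times its first eigenvalue. -/
lemma matrixAvgR_lower_fst {V : ℝ → Matrix (Fin 2) (Fin 2) ℝ} {δ₁ δ₂ T : ℝ}
    (hV : ∀ i j, LocallyIntegrable (fun x => V x i j) volume)
    (hVx : ∀ x, x ≠ 0 → V x = rotatedDiagonal (|x| ^ δ₁) (|x| ^ δ₂) x)
    (hδ : -1 ≤ δ₁) (hT : π ≤ T) (u v : ℝ) :
    T ^ δ₁ / 2 / 2 * (u ^ 2 + v ^ 2) ≤
      matrixAvgR 2 V T (T + π) 0 0 * u ^ 2 +
        (matrixAvgR 2 V T (T + π) 0 1 + matrixAvgR 2 V T (T + π) 1 0) * (u * v) +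
        matrixAvgR 2 V T (T + π) 1 1 * v ^ 2 := by
  have hT0 : 0 < T := pi_pos.trans_le hT
  refine matrixAvgR_quadratic_lower (φ := 0) hV (fun x hx u v => ?_) u v
  have hx0 : 0 < x := hT0.trans_le hx.1
  rw [hVx x hx0.ne', rotatedDiagonal_quadratic, abs_of_pos hx0, add_zero]
  have h1 := half_rpow_le_rpow hT0 hx.1 (by linarith [hx.2]) hδ
  have h2 := mul_le_mul_of_nonneg_right h1 (sq_nonneg (cos x * u + sin x * v))
  have h3 := mul_nonneg (rpow_nonneg hx0.le δ₂) (sq_nonneg (-sin x * u + cos x * v))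
  linarith

lemma matrixAvgR_lower_snd {V : ℝ → Matrix (Fin 2) (Fin 2) ℝ} {δ₁ δ₂ T : ℝ}
    (hV : ∀ i j, LocallyIntegrable (fun x => V x i j) volume)
    (hVx : ∀ x, x ≠ 0 → V x = rotatedDiagonal (|x| ^ δ₁) (|x| ^ δ₂) x)
    (hδ : -1 ≤ δ₂) (hT : π ≤ T) (u v : ℝ) :
    T ^ δ₂ / 2 / 2 * (u ^ 2 + v ^ 2) ≤
      matrixAvgR 2 V T (T + π) 0 0 * u ^ 2 +
        (matrixAvgR 2 V T (T + π) 0 1 + matrixAvgR 2 V T (T + π) 1 0) * (u * v) +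
        matrixAvgR 2 V T (T + π) 1 1 * v ^ 2 := by
  have hT0 : 0 < T := pi_pos.trans_le hT
  refine matrixAvgR_quadratic_lower (φ := π / 2) hV (fun x hx u v => ?_) u v
  have hx0 : 0 < x := hT0.trans_le hx.1
  rw [hVx x hx0.ne', rotatedDiagonal_quadratic, abs_of_pos hx0, cos_add_pi_div_two,
    sin_add_pi_div_two]
  have h1 := half_rpow_le_rpow hT0 hx.1 (by linarith [hx.2]) hδ
  have h2 := mul_le_mul_of_nonneg_right h1 (sq_nonneg (-sin x * u + cos x * v))
  have h3 := mul_nonneg (rpow_nonneg hx0.le δ₁) (sq_nonneg (cos x * u + sin x * v))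
  linarith

/-- Local integrability of a rotated diagonal power weight bounds both exponents below. -/
lemma neg_one_lt_of_locallyIntegrable {V : ℝ → Matrix (Fin 2) (Fin 2) ℝ} {δ₁ δ₂ : ℝ}
    (hV : ∀ i j, LocallyIntegrable (fun x => V x i j) volume)
    (hVx : ∀ x, x ≠ 0 → V x = rotatedDiagonal (|x| ^ δ₁) (|x| ^ δ₂) x) :
    -1 < δ₁ ∧ -1 < δ₂ := by
  have hsum : IntegrableOn (fun x => V x 0 0 + V x 1 1) (Set.Ioo 0 1) volume :=
    (((hV 0 0).add (hV 1 1)).integrableOn_isCompact isCompact_Icc).mono_set Set.Ioo_subset_Icc_self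
  have key : ∀ δ : ℝ, (∀ x ∈ Set.Ioo (0 : ℝ) 1, x ^ δ ≤ V x 0 0 + V x 1 1) → -1 < δ := by
    intro δ h
    rw [← intervalIntegral.integrableOn_Ioo_rpow_iff zero_lt_one]
    refine Integrable.mono' hsum (Measurable.pow_const measurable_id δ).aestronglyMeasurable ?_
    filter_upwards [ae_restrict_mem measurableSet_Ioo] with x hx
    rw [norm_of_nonneg (rpow_nonneg hx.1.le δ)]
    exact h x hx
  constructor <;> refine key _ fun x hx => ?_ <;>
    rw [hVx x hx.1.ne', rotatedDiagonal_trace, abs_of_pos hx.1]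
  · linarith [rpow_nonneg hx.1.le δ₂]
  · linarith [rpow_nonneg hx.1.le δ₁]

lemma nonpos_of_rpow_bounded {δ C : ℝ} (h : ∀ T : ℝ, π ≤ T → T ^ δ ≤ C) : δ ≤ 0 := by
  by_contra! hδ
  obtain ⟨T, hT, hT'⟩ := ((Filter.eventually_ge_atTop π).and
    ((tendsto_rpow_atTop hδ).eventually_gt_atTop C)).exists
  linarith [h T hT]

/-- The Type 2 matrix power function
`W(x) = R(x) diag(|x|^γ₁, |x|^γ₂) R(x)ᵀ`, where `R(x)` is the rotation matrix through
angle `x`, is an `A₂` matrix weight iff `γ₁ = γ₂` and `-1 < γ₁ < 1`. -/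
theorem rotation_power_isA2_iff (γ₁ γ₂ : ℝ)
    (W : ℝ → Matrix (Fin 2) (Fin 2) ℝ)
    (hW : ∀ x : ℝ, W x =
      !![cos x, -sin x; sin x, cos x] *
        Matrix.diagonal ![|x| ^ γ₁, |x| ^ γ₂] *
        (!![cos x, -sin x; sin x, cos x])ᵀ) :
    IsA2MatrixWeightR 2 W ↔ (γ₁ = γ₂ ∧ -1 < γ₁ ∧ γ₁ < 1) := by
  simp_rw [rotation_mul_diagonal_mul_transpose] at hW
  constructor
  · rintro ⟨-, hI, hI', C, hC⟩
    have hW' : ∀ x, x ≠ 0 → (W x)⁻¹ = rotatedDiagonal (|x| ^ (-γ₁)) (|x| ^ (-γ₂)) x := by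
      intro x hx
      have hx' := abs_pos.2 hx
      rw [hW, rotatedDiagonal_inv (rpow_pos_of_pos hx' _).ne' (rpow_pos_of_pos hx' _).ne',
        rpow_neg hx'.le, rpow_neg hx'.le]
    obtain ⟨l₁, l₂⟩ := neg_one_lt_of_locallyIntegrable hI fun x _ => hW x
    obtain ⟨r₁, r₂⟩ := neg_one_lt_of_locallyIntegrable hI' hW'
    have sW : ∀ x, W x 1 0 = W x 0 1 := fun x => by rw [hW, rotatedDiagonal_symm]
    have sW' : ∀ x, (W x)⁻¹ 1 0 = (W x)⁻¹ 0 1 := fun x => by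
      simp [inv_def, adjugate_fin_two, sW]
    have hTC : ∀ T : ℝ, π ≤ T → T ^ (γ₁ - γ₂) ≤ 8 * C ∧ T ^ (γ₂ - γ₁) ≤ 8 * C := by
      intro T hT
      have hT0 : 0 < T := pi_pos.trans_le hT
      have hC' := hC T (T + π) (by linarith [pi_pos])
      have p : ∀ δ : ℝ, 0 ≤ T ^ δ / 2 / 2 := fun δ => by positivity
      have h₁ := two_mul_le_trace_mul (p _) (p _) (matrixAvgR_symm sW _ _)
        (matrixAvgR_symm sW' _ _)
        (matrixAvgR_lower_fst hI (fun x _ => hW x) l₁.le hT)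
        (matrixAvgR_lower_snd hI' hW' r₂.le hT)
      have h₂ := two_mul_le_trace_mul (p _) (p _) (matrixAvgR_symm sW _ _)
        (matrixAvgR_symm sW' _ _)
        (matrixAvgR_lower_snd hI (fun x _ => hW x) l₂.le hT)
        (matrixAvgR_lower_fst hI' hW' r₁.le hT)
      rw [sub_eq_add_neg, sub_eq_add_neg, rpow_add hT0, rpow_add hT0]
      constructor <;> linarith
    have h₁ := nonpos_of_rpow_bounded fun T hT => (hTC T hT).1
    have h₂ := nonpos_of_rpow_bounded fun T hT => (hTC T hT).2
    exact ⟨by linarith, l₁, by linarith⟩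
  · rintro ⟨rfl, h₁, h₂⟩
    have hW₁ : ∀ x, W x = |x| ^ γ₁ • (1 : Matrix (Fin 2) (Fin 2) ℝ) := fun x => by
      rw [hW, rotatedDiagonal_self]
    have hW₂ : ∀ x, (W x)⁻¹ = |x| ^ (-γ₁) • (1 : Matrix (Fin 2) (Fin 2) ℝ) := fun x => by
      rw [hW₁, rpow_neg (abs_nonneg x)]
      by_cases h : |x| ^ γ₁ = 0
      · simp [h]
      · exact inv_eq_right_inv (by simp [smul_smul, h])
    refine ⟨?_, fun i j => ?_, fun i j => ?_, 2 * (16 / ((1 + γ₁) * (1 - γ₁))), fun a b hab => ?_⟩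
    · filter_upwards [Measure.ae_ne volume (0 : ℝ)] with x hx
      rw [hW₁]
      exact PosDef.one.smul (rpow_pos_of_pos (abs_pos.2 hx) _)
    · simp only [hW₁, Matrix.smul_apply, smul_eq_mul, mul_comm _ ((1 : Matrix (Fin 2) (Fin 2) ℝ) i j)]
      exact (locallyIntegrable_abs_rpow h₁).smul ((1 : Matrix (Fin 2) (Fin 2) ℝ) i j)
    · simp only [hW₂, Matrix.smul_apply, smul_eq_mul, mul_comm _ ((1 : Matrix (Fin 2) (Fin 2) ℝ) i j)]
      exact (locallyIntegrable_abs_rpow (by linarith)).smul ((1 : Matrix (Fin 2) (Fin 2) ℝ) i j)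
    · have h := integral_abs_rpow_mul_integral_abs_rpow_neg_le h₁ h₂ hab
      have hba : 0 < b - a := sub_pos.2 hab
      have h' := (div_le_iff₀ (pow_pos hba 2)).2 h
      calc _ = 2 * ((∫ x in a..b, |x| ^ γ₁) * (∫ x in a..b, |x| ^ (-γ₁)) / (b - a) ^ 2) := by
            simp only [matrixAvgR, trace_fin_two, mul_apply, Fin.sum_univ_two, hW₂]
            simp [hW₁]
            field_simp
            ring
        _ ≤ _ := by linarith
end

section
/- Let γ₁, γ₂ ∈ ℝ with γ₂ > γ₁, and define w(x) = |x|^{γ₁}cos²x + |x|^{γ₂}sin²x. Then w is not a scalar A₂ weight; that is, sup_I ⟨w⟩_I ⟨w^{-1}⟩_I = ∞, where the supremum is over bounded intervals I of positive length and ⟨f⟩_I = (1/|I|)∫_I f(x) dx. -/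
open MeasureTheory Real

/-- On the dyadic interval `[A, 2A]` the power `x ^ γ` is comparable to `A ^ γ`. -/
lemma rpow_comparable_of_mem_Icc {A x : ℝ} (hA : 0 < A) (h1 : A ≤ x) (h2 : x ≤ 2 * A) (γ : ℝ) :
    2 ^ (-|γ|) * A ^ γ ≤ x ^ γ ∧ x ^ γ ≤ 2 ^ |γ| * A ^ γ := by
  have ht1 : 1 ≤ x / A := by rwa [one_le_div hA]
  have ht2 : x / A ≤ 2 := by rwa [div_le_iff₀ hA]
  have hx : x ^ γ = (x / A) ^ γ * A ^ γ := by
    rw [← mul_rpow (by positivity) hA.le, div_mul_cancel₀ _ hA.ne']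
  have hAγ : 0 ≤ A ^ γ := by positivity
  rw [hx]
  constructor
  · gcongr
    calc (2 : ℝ) ^ (-|γ|) ≤ (x / A) ^ (-|γ|) :=
          rpow_le_rpow_of_nonpos (by positivity) ht2 (by simp)
      _ ≤ (x / A) ^ γ := rpow_le_rpow_of_exponent_le ht1 (neg_abs_le γ)
  · gcongr
    calc (x / A) ^ γ ≤ (x / A) ^ |γ| := rpow_le_rpow_of_exponent_le ht1 (le_abs_self γ)
      _ ≤ 2 ^ |γ| := rpow_le_rpow (by positivity) ht2 (abs_nonneg γ)

/-- A nonnegative continuous function that is at least `m` on a subinterval `[c, d]` has integral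
at least `m * (d - c)`. -/
lemma mul_sub_le_intervalIntegral {f : ℝ → ℝ} {a b c d m : ℝ} (hac : a ≤ c) (hcd : c ≤ d)
    (hdb : d ≤ b) (hf : ContinuousOn f (Set.Icc a b)) (h0 : ∀ x ∈ Set.Icc a b, 0 ≤ f x)
    (hm : ∀ x ∈ Set.Icc c d, m ≤ f x) : m * (d - c) ≤ ∫ x in a..b, f x := by
  have hab : a ≤ b := hac.trans (hcd.trans hdb)
  have hsub : Set.Icc c d ⊆ Set.Icc a b := Set.Icc_subset_Icc hac hdb
  calc m * (d - c) = ∫ _ in c..d, m := by simp [mul_comm]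
    _ ≤ ∫ x in c..d, f x := intervalIntegral.integral_mono_on hcd (by simp)
        ((hf.mono hsub).intervalIntegrable_of_Icc hcd) hm
    _ ≤ ∫ x in a..b, f x := by
      refine intervalIntegral.integral_mono_interval hac hcd hdb ?_
        (hf.intervalIntegrable_of_Icc hab)
      filter_upwards [ae_restrict_mem measurableSet_Ioc] with x hx
      exact h0 x (Set.Ioc_subset_Icc_self hx)

/-- For `γ₂ > γ₁`, the function
`w(x) = |x|^γ₁ cos²x + |x|^γ₂ sin²x` is not a scalar `A₂` weight:
`sup_I ⟨w⟩_I ⟨w⁻¹⟩_I = ∞`, i.e. there is no finite bound `C` valid for all bounded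
intervals `I = (a, b)` of positive length. -/
theorem rotation_entry_not_A2 (γ₁ γ₂ : ℝ) (h : γ₁ < γ₂)
    (w : ℝ → ℝ)
    (hw : ∀ x : ℝ, w x = |x| ^ γ₁ * cos x ^ 2 + |x| ^ γ₂ * sin x ^ 2) :
    ¬ ∃ C : ℝ, ∀ a b : ℝ, a < b →
      ((b - a)⁻¹ * ∫ x in a..b, w x) * ((b - a)⁻¹ * ∫ x in a..b, (w x)⁻¹) ≤ C := by
  rintro ⟨C, hC⟩
  set K : ℝ := 2 ^ |γ₁| + 2 ^ |γ₂| with hK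
  set k : ℝ := 2 ^ (-|γ₂|) with hk
  have hK0 : 0 < K := by positivity
  have hk0 : 0 < k := by positivity
  have hlim : Filter.Tendsto (fun n : ℕ => k / (32 * K) * ((n : ℝ) * (2 * π)) ^ ((γ₂ - γ₁) / 2))
      Filter.atTop Filter.atTop :=
    ((tendsto_rpow_atTop (by linarith)).comp
      (tendsto_natCast_atTop_atTop.atTop_mul_const (by positivity))).const_mul_atTop
        (by positivity)
  obtain ⟨n, hnC, hn1⟩ := ((hlim.eventually_gt_atTop C).and (Filter.eventually_ge_atTop 1)).exists
  set A : ℝ := (n : ℝ) * (2 * π) with hA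
  have hA1 : 1 ≤ A := by
    have : (1 : ℝ) ≤ n := by exact_mod_cast hn1
    nlinarith [pi_gt_three]
  have hA0 : 0 < A := by linarith
  have hsin (x : ℝ) : sin x = sin (x - A) := by
    rw [hA, sin_sub_nat_mul_two_pi]
  have hpos : ∀ x ∈ Set.Icc A (A + 1), 0 < w x := by
    intro x hx
    have hx0 : 0 < |x| := abs_pos.2 (by linarith [hx.1])
    have p1 := rpow_pos_of_pos hx0 γ₁
    have p2 := rpow_pos_of_pos hx0 γ₂
    rw [hw]
    rcases (sq_nonneg (sin x)).eq_or_lt with hs | hs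
    · rw [← hs, cos_sq', ← hs]; linarith
    · positivity
  have hcont : ContinuousOn w (Set.Icc A (A + 1)) := by
    have hne : ∀ x ∈ Set.Icc A (A + 1), |x| ≠ 0 := fun x hx =>
      abs_ne_zero.2 (by linarith [hx.1])
    rw [funext hw]
    exact ((continuous_abs.continuousOn.rpow_const fun x hx => .inl (hne x hx)).mul
      (by fun_prop)).add
      ((continuous_abs.continuousOn.rpow_const fun x hx => .inl (hne x hx)).mul (by fun_prop))
  set s : ℝ := A ^ (-((γ₂ - γ₁) / 2)) with hs
  have hs0 : 0 < s := by positivity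
  have hs1 : s ≤ 1 := rpow_le_one_of_one_le_of_nonpos hA1 (by linarith)
  have hAs : A ^ γ₂ * s ^ 2 = A ^ γ₁ := by
    rw [hs, ← rpow_natCast, ← rpow_mul hA0.le, ← rpow_add hA0]
    congr 1; push_cast; ring
  have hint : k * A ^ γ₂ / 16 * ((A + 1) - (A + 1 / 2)) ≤ ∫ x in A..(A + 1), w x := by
    refine mul_sub_le_intervalIntegral (by linarith) (by linarith) le_rfl hcont
      (fun x hx => (hpos x hx).le) fun x hx => ?_
    have hx1 : A + 1 / 2 ≤ x := hx.1
    have hx2 : x ≤ A + 1 := hx.2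
    have hS : 1 / 4 ≤ sin x := by
      rw [hsin]
      have := mul_le_sin (x := x - A) (by linarith) (by linarith [pi_gt_three])
      refine le_trans ?_ this
      rw [div_mul_eq_mul_div, le_div_iff₀ pi_pos]
      linarith [pi_le_four]
    have hS2 : 1 / 16 ≤ sin x ^ 2 := by nlinarith
    have hb := (rpow_comparable_of_mem_Icc hA0 (x := x) (by linarith) (by linarith) γ₂).1
    rw [hw, abs_of_pos (by linarith : 0 < x)]
    have hx0 : 0 < x := by linarith
    calc k * A ^ γ₂ / 16 = (k * A ^ γ₂) * (1 / 16) := by ring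
      _ ≤ x ^ γ₂ * sin x ^ 2 := by gcongr
      _ ≤ _ := le_add_of_nonneg_left (by positivity)
  have hinv : (K * A ^ γ₁)⁻¹ * ((A + s) - A) ≤ ∫ x in A..(A + 1), (w x)⁻¹ := by
    refine mul_sub_le_intervalIntegral le_rfl (by linarith) (by linarith)
      (hcont.inv₀ fun x hx => (hpos x hx).ne') (fun x hx => (inv_pos.2 (hpos x hx)).le)
      fun x hx => ?_
    have hx1 : A ≤ x := hx.1
    have hx2 : x ≤ A + s := hx.2
    refine inv_anti₀ (hpos x ⟨hx1, by linarith⟩) ?_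
    have hx0 : 0 < x := by linarith
    have hb1 := (rpow_comparable_of_mem_Icc hA0 (x := x) hx1 (by linarith) γ₁).2
    have hb2 := (rpow_comparable_of_mem_Icc hA0 (x := x) hx1 (by linarith) γ₂).2
    have hS : sin x ^ 2 ≤ s ^ 2 := by
      rw [hsin]
      exact sin_sq_le_sq.trans (pow_le_pow_left₀ (by linarith) (by linarith) 2)
    rw [hw, abs_of_pos hx0]
    calc x ^ γ₁ * cos x ^ 2 + x ^ γ₂ * sin x ^ 2
        ≤ (2 ^ |γ₁| * A ^ γ₁) * 1 + (2 ^ |γ₂| * A ^ γ₂) * s ^ 2 := by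
          gcongr
          exact cos_sq_le_one x
      _ = K * A ^ γ₁ := by rw [mul_assoc _ (A ^ γ₂), hAs, hK]; ring
  have hfinal := hC A (A + 1) (by linarith)
  have hprod := mul_le_mul hint hinv (by simp only [add_sub_cancel_left]; positivity)
    (le_trans (by ring_nf; positivity) hint)
  simp only [add_sub_cancel_left, inv_one, one_mul] at hfinal
  have heq : k * A ^ γ₂ / 16 * ((A + 1) - (A + 1 / 2)) * ((K * A ^ γ₁)⁻¹ * ((A + s) - A))
      = k / (32 * K) * A ^ ((γ₂ - γ₁) / 2) := by
    have hsA : A ^ ((γ₂ - γ₁) / 2) = s⁻¹ := by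
      rw [hs, rpow_neg hA0.le, inv_inv]
    have hA2 : 0 < A ^ γ₂ := by positivity
    rw [← hAs, hsA]
    field_simp
    ring
  linarith
end

section
/- Let γ₁, γ₂ ∈ ℝ with γ₂ > γ₁, let w(x) = |x|^{γ₁}cos²x + |x|^{γ₂}sin²x, and for n ∈ ℕ let I_n = [2πn, 2πn + π]. Then there exists a constant c > 0 (independent of n) such that for all sufficiently large n, (1/|I_n|)∫_{I_n} w(x) dx ≥ c·n^{γ₂}. -/
open MeasureTheory Real

lemma min_one_rpow_mul_rpow_le {a b x : ℝ} (γ : ℝ) (ha : 0 < a) (hax : a ≤ x) (hxb : x ≤ b * a) :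
    min 1 (b ^ γ) * a ^ γ ≤ x ^ γ := by
  have h1 : 1 ≤ x / a := (one_le_div ha).2 hax
  have hb : x / a ≤ b := (div_le_iff₀ ha).2 hxb
  have key : min 1 (b ^ γ) ≤ (x / a) ^ γ := by
    rcases le_total 0 γ with hγ | hγ
    · exact (min_le_left _ _).trans (one_le_rpow h1 hγ)
    · exact (min_le_right _ _).trans (rpow_le_rpow_of_nonpos (by linarith) hb hγ)
  calc min 1 (b ^ γ) * a ^ γ ≤ (x / a) ^ γ * a ^ γ := by gcongr
    _ = x ^ γ := by
      rw [← mul_rpow (by linarith) ha.le, div_mul_cancel₀ _ ha.ne']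

lemma integral_sin_sq_two_pi_mul_nat (n : ℕ) :
    ∫ x in (2 * π * n)..(2 * π * n + π), sin x ^ 2 = π / 2 := by
  have hs : sin (2 * π * n) = 0 := by
    rw [show 2 * π * n = ((2 * n : ℕ) : ℝ) * π by push_cast; ring]
    exact sin_nat_mul_pi _
  rw [integral_sin_sq, sin_add_pi, hs]
  ring

/-- For `γ₂ > γ₁` and `w(x) = |x|^γ₁ cos²x + |x|^γ₂ sin²x`, there is a
constant `c > 0`, independent of `n`, such that for all sufficiently large `n`, the
average of `w` over `I_n = [2πn, 2πn + π]` is at least `c · n^γ₂`. -/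
theorem rotation_entry_avg_lower_bound (γ₁ γ₂ : ℝ) (h : γ₁ < γ₂)
    (w : ℝ → ℝ)
    (hw : ∀ x : ℝ, w x = |x| ^ γ₁ * cos x ^ 2 + |x| ^ γ₂ * sin x ^ 2) :
    ∃ c : ℝ, 0 < c ∧ ∃ N : ℕ, ∀ n : ℕ, N ≤ n →
      c * (n : ℝ) ^ γ₂ ≤
        π⁻¹ * ∫ x in (2 * π * n)..(2 * π * n + π), w x := by
  refine ⟨min 1 (10 ^ γ₂) / 2, by positivity, 1, fun n hn => ?_⟩
  have hn1 : (1 : ℝ) ≤ n := by exact_mod_cast hn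
  have hπ := pi_gt_three
  have hπ' := pi_lt_d2
  have hab : 2 * π * n ≤ 2 * π * n + π := by linarith
  have hlow : (n : ℝ) ≤ 2 * π * n := by nlinarith
  have hupp : 2 * π * n + π ≤ 10 * n := by nlinarith
  have hcont : ContinuousOn w (Set.uIcc (2 * π * n) (2 * π * n + π)) := by
    have hne : ∀ x ∈ Set.uIcc (2 * π * n) (2 * π * n + π), |x| ≠ 0 := by
      intro x hx
      rw [Set.uIcc_of_le hab] at hx
      exact abs_ne_zero.2 (by linarith [hx.1])
    have hrpow (γ : ℝ) :
        ContinuousOn (fun x : ℝ => |x| ^ γ) (Set.uIcc (2 * π * n) (2 * π * n + π)) :=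
      continuous_abs.continuousOn.rpow_const fun x hx => Or.inl (hne x hx)
    rw [funext hw]
    exact ((hrpow γ₁).mul (by fun_prop)).add ((hrpow γ₂).mul (by fun_prop))
  have hmono : ∫ x in (2 * π * n)..(2 * π * n + π), min 1 (10 ^ γ₂) * (n : ℝ) ^ γ₂ * sin x ^ 2 ≤
      ∫ x in (2 * π * n)..(2 * π * n + π), w x := by
    refine intervalIntegral.integral_mono_on hab
      (Continuous.intervalIntegrable (by fun_prop) _ _) hcont.intervalIntegrable fun x hx => ?_
    have hnx : (n : ℝ) ≤ x := hlow.trans hx.1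
    have hle : min 1 (10 ^ γ₂) * (n : ℝ) ^ γ₂ ≤ |x| ^ γ₂ := by
      rw [abs_of_nonneg (by linarith)]
      exact min_one_rpow_mul_rpow_le γ₂ (by linarith) hnx (hx.2.trans hupp)
    rw [hw]
    have hcos : 0 ≤ |x| ^ γ₁ * cos x ^ 2 := by positivity
    linarith [mul_le_mul_of_nonneg_right hle (sq_nonneg (sin x))]
  rw [intervalIntegral.integral_const_mul, integral_sin_sq_two_pi_mul_nat] at hmono
  calc min 1 (10 ^ γ₂) / 2 * (n : ℝ) ^ γ₂
      = π⁻¹ * (min 1 (10 ^ γ₂) * (n : ℝ) ^ γ₂ * (π / 2)) := by field_simp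
    _ ≤ _ := by gcongr
end

section
/- Let γ₁, γ₂ ∈ ℝ with γ₂ > γ₁, let w(x) = |x|^{γ₁}cos²x + |x|^{γ₂}sin²x, and for n ∈ ℕ let I_n = [2πn, 2πn + π]. Then there exists a constant c > 0 (depending only on γ₁ and γ₂) such that for all sufficiently large n, (1/|I_n|)∫_{I_n} (1/w(x)) dx ≥ c·n^{(−γ₁−γ₂)/2}. -/
open MeasureTheory Real

/-- If `x / s` lies in `[1, b]`, then `x ^ γ` is at most `b ^ |γ|` times `s ^ γ`, whatever
the sign of `γ`. -/
lemma rpow_le_rpow_abs_mul_rpow {s x b : ℝ} (γ : ℝ) (hs : 0 < s) (hsx : s ≤ x)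
    (hxb : x ≤ b * s) : x ^ γ ≤ b ^ |γ| * s ^ γ := by
  have h1 : 1 ≤ x / s := (one_le_div hs).2 hsx
  have hb : x / s ≤ b := (div_le_iff₀ hs).2 hxb
  calc x ^ γ = (x / s) ^ γ * s ^ γ := by
        rw [← mul_rpow (by positivity) hs.le, div_mul_cancel₀ _ hs.ne']
    _ ≤ b ^ |γ| * s ^ γ := by
        gcongr
        exact (rpow_le_rpow_of_exponent_le h1 (le_abs_self γ)).trans
          (rpow_le_rpow (by positivity) hb (abs_nonneg γ))

lemma mul_cos_sq_add_mul_sin_sq_pos {a b : ℝ} (ha : 0 < a) (hb : 0 < b) (x : ℝ) :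
    0 < a * cos x ^ 2 + b * sin x ^ 2 := by
  rcases eq_or_ne (sin x) 0 with hx | hx
  · have : cos x ^ 2 = 1 := by rw [cos_sq', hx]; norm_num
    rw [this, hx]
    linarith
  · have : 0 < sin x ^ 2 := by positivity
    have := mul_pos hb this
    positivity

lemma sin_sq_le_sq_sub_nat_mul_two_pi (x : ℝ) (n : ℕ) :
    sin x ^ 2 ≤ (x - 2 * π * n) ^ 2 := by
  have : sin x = sin (x - 2 * π * n) := by
    rw [mul_comm (2 * π), sin_sub_nat_mul_two_pi]
  rw [this]
  exact sq_le_sq.2 abs_sin_le_abs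

/-- For `γ₂ > γ₁` and `w(x) = |x|^γ₁ cos²x + |x|^γ₂ sin²x`, there is a
constant `c > 0`, depending only on `γ₁` and `γ₂`, such that for all sufficiently
large `n`, the average of `1/w` over `I_n = [2πn, 2πn + π]` is at least
`c · n^((-γ₁ - γ₂)/2)`. -/
theorem rotation_entry_inv_avg_lower_bound (γ₁ γ₂ : ℝ) (h : γ₁ < γ₂)
    (w : ℝ → ℝ)
    (hw : ∀ x : ℝ, w x = |x| ^ γ₁ * cos x ^ 2 + |x| ^ γ₂ * sin x ^ 2) :
    ∃ c : ℝ, 0 < c ∧ ∃ N : ℕ, ∀ n : ℕ, N ≤ n →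
      c * (n : ℝ) ^ ((-γ₁ - γ₂) / 2) ≤
        π⁻¹ * ∫ x in (2 * π * n)..(2 * π * n + π), (w x)⁻¹ := by
  set K : ℝ := 10 ^ |γ₁| + 10 ^ |γ₂| with hK
  have hKpos : 0 < K := by positivity
  refine ⟨π⁻¹ * K⁻¹, by positivity, 1, fun n hn => ?_⟩
  have hn1 : (1 : ℝ) ≤ n := by exact_mod_cast hn
  have hn0 : (0 : ℝ) < n := by linarith
  have hπ3 := pi_gt_three
  have hπ4 := pi_lt_four
  have ha : (n : ℝ) ≤ 2 * π * n := by nlinarith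
  set ε : ℝ := (n : ℝ) ^ ((γ₁ - γ₂) / 2) with hε
  have hε0 : 0 < ε := by positivity
  have hε1 : ε ≤ 1 := rpow_le_one_of_one_le_of_nonpos hn1 (by linarith)
  have hε2 : (n : ℝ) ^ γ₂ * ε ^ 2 = (n : ℝ) ^ γ₁ := by
    rw [hε, ← rpow_natCast, ← rpow_mul hn0.le, ← rpow_add hn0]
    congr 1
    push_cast
    ring
  have hpos : ∀ x, (n : ℝ) ≤ x → 0 < w x := fun x hx => by
    have : 0 < |x| := abs_pos.2 (by linarith)
    rw [hw]
    exact mul_cos_sq_add_mul_sin_sq_pos (by positivity) (by positivity) x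
  have hupper : ∀ x ∈ Set.Icc (2 * π * n) (2 * π * n + ε), w x ≤ K * (n : ℝ) ^ γ₁ := by
    intro x hx
    have hnx : (n : ℝ) ≤ x := ha.trans hx.1
    have hxn : x ≤ 10 * n := by nlinarith [hx.2]
    have hsin : sin x ^ 2 ≤ ε ^ 2 :=
      (sin_sq_le_sq_sub_nat_mul_two_pi x n).trans
        (pow_le_pow_left₀ (by linarith [hx.1]) (by linarith [hx.2]) 2)
    rw [hw, abs_of_pos (hn0.trans_le hnx)]
    calc x ^ γ₁ * cos x ^ 2 + x ^ γ₂ * sin x ^ 2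
        ≤ 10 ^ |γ₁| * (n : ℝ) ^ γ₁ * 1 + 10 ^ |γ₂| * (n : ℝ) ^ γ₂ * ε ^ 2 := by
          gcongr
          · exact rpow_le_rpow_abs_mul_rpow γ₁ hn0 hnx hxn
          · exact cos_sq_le_one x
          · exact rpow_le_rpow_abs_mul_rpow γ₂ hn0 hnx hxn
      _ = K * (n : ℝ) ^ γ₁ := by rw [mul_assoc _ _ (ε ^ 2), hε2, hK]; ring
  have hint : IntervalIntegrable (fun x => (w x)⁻¹) volume (2 * π * n) (2 * π * n + π) := by
    apply ContinuousOn.intervalIntegrable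
    rw [Set.uIcc_of_le (by linarith)]
    refine ContinuousOn.inv₀ ?_ fun x hx => (hpos x (ha.trans hx.1)).ne'
    have habs : ∀ x ∈ Set.Icc (2 * π * n) (2 * π * n + π), |x| ≠ 0 := fun x hx =>
      abs_ne_zero.2 (by linarith [hx.1])
    rw [funext hw]
    exact ((continuous_abs.continuousOn.rpow_const fun x hx => .inl (habs x hx)).mul
      (by fun_prop)).add
      ((continuous_abs.continuousOn.rpow_const fun x hx => .inl (habs x hx)).mul (by fun_prop))
  have hint' : IntervalIntegrable (fun x => (w x)⁻¹) volume (2 * π * n) (2 * π * n + ε) :=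
    hint.mono_set (by
      rw [Set.uIcc_of_le (by linarith), Set.uIcc_of_le (by linarith)]
      exact Set.Icc_subset_Icc_right (by linarith))
  rw [mul_assoc]
  gcongr
  calc K⁻¹ * (n : ℝ) ^ ((-γ₁ - γ₂) / 2)
      = ∫ _ in (2 * π * n)..(2 * π * n + ε), (K * (n : ℝ) ^ γ₁)⁻¹ := by
        rw [intervalIntegral.integral_const, add_sub_cancel_left, smul_eq_mul, mul_inv,
          ← rpow_neg hn0.le, mul_left_comm, hε, ← rpow_add hn0]
        congr 2
        ring
    _ ≤ ∫ x in (2 * π * n)..(2 * π * n + ε), (w x)⁻¹ :=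
        intervalIntegral.integral_mono_on (by linarith) intervalIntegrable_const hint'
          fun x hx => inv_anti₀ (hpos x (ha.trans hx.1)) (hupper x hx)
    _ ≤ ∫ x in (2 * π * n)..(2 * π * n + π), (w x)⁻¹ := by
        refine intervalIntegral.integral_mono_interval le_rfl (by linarith) (by linarith) ?_ hint
        filter_upwards [ae_restrict_mem measurableSet_Ioc] with x hx
        exact (inv_pos.2 (hpos x (ha.trans hx.1.le))).le
end
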